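/- arXiv:1308.5065 — 2 statements merged into one kernel-verified Lean document; each statement's English description precedes it below -/
import Mathlib

section
/- Let g ∈ L²(ℝ) be (a.e. equal to) a bounded measurable function with compact support. Then for any a, b > 0, the Gabor system {E_{mb}T_{na}g}_{m,n∈ℤ} is a Bessel sequence in L²(ℝ). -/
open scoped InnerProductSpace
open MeasureTheory Complex Real

noncomputable section

/-- The space `L²(ℝ)` of complex square-integrable functions. -/
abbrev L2R := Lp ℂ 2 (volume : Measure ℝ)

/-- The Gabor function `E_{mb}T_{na} g : x ↦ e^{2πimbx} g(x - na)`. -/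
def gaborFun (g : ℝ → ℂ) (a b : ℝ) (m n : ℤ) : ℝ → ℂ :=
  fun x => Complex.exp (2 * Real.pi * Complex.I * (m * b * x)) * g (x - n * a)

/-- `G : ℤ × ℤ → L²(ℝ)` represents the Gabor system `{E_{mb}T_{na} g}_{m,n ∈ ℤ}`. -/
def RepresentsGabor (G : ℤ × ℤ → L2R) (g : ℝ → ℂ) (a b : ℝ) : Prop :=
  ∀ p : ℤ × ℤ, (G p : ℝ → ℂ) =ᵐ[volume] gaborFun g a b p.1 p.2

/-- `f` is a Bessel sequence with bound `B`. -/
def IsBesselWith {ι : Type*} (f : ι → L2R) (B : ℝ) : Prop :=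
  ∀ x : L2R, Summable (fun i => ‖⟪x, f i⟫_ℂ‖ ^ 2) ∧
    ∑' i, ‖⟪x, f i⟫_ℂ‖ ^ 2 ≤ B * ‖x‖ ^ 2

/-- Parseval's identity for the exponentials `e^{2πimbx}` on an interval of length `1 / b`. -/
lemma tsum_enorm_integral_exp_mul_sq {b : ℝ} (hb : 0 < b) (c : ℝ) {h : ℝ → ℂ}
    (hh : MemLp h 2 volume) :
    ∑' m : ℤ, ‖∫ x in Set.Ioc c (c + 1 / b),
        Complex.exp (2 * Real.pi * Complex.I * (m * b * x)) * h x‖ₑ ^ 2 =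
      ENNReal.ofReal (1 / b) * ∫⁻ x in Set.Ioc c (c + 1 / b), ‖h x‖ₑ ^ 2 := by
  have hb' : (0 : ℝ) < 1 / b := by positivity
  have hcb : c < c + 1 / b := by linarith
  have hr : MemLp h 2 (volume.restrict (Set.Ioc c (c + 1 / b))) := hh.restrict _
  have hcoeff (m : ℤ) : ∫ x in Set.Ioc c (c + 1 / b),
      Complex.exp (2 * Real.pi * Complex.I * (m * b * x)) * h x =
        ((1 / b : ℝ) : ℂ) * fourierCoeffOn hcb h (-m) := by
    rw [fourierCoeffOn_eq_integral, intervalIntegral.integral_of_le hcb.le]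
    rw [Complex.real_smul, ← mul_assoc, ← Complex.ofReal_mul]
    rw [show (1 / b) * (1 / (c + 1 / b - c)) = 1 by rw [add_sub_cancel_left]; field_simp]
    rw [Complex.ofReal_one, one_mul]
    refine integral_congr_ae (Filter.Eventually.of_forall fun x => ?_)
    simp only [neg_neg, smul_eq_mul, fourier_coe_apply]
    congr 2
    rw [add_sub_cancel_left]
    push_cast
    field_simp
  have hint : Integrable (fun x => ‖h x‖ ^ 2) (volume.restrict (Set.Ioc c (c + 1 / b))) :=
    hr.integrable_norm_pow two_ne_zero
  have hs := hasSum_sq_fourierCoeffOn hcb hr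
  have hs' := hs.mul_left ((1 / b) ^ 2)
  rw [← (Equiv.neg ℤ).hasSum_iff] at hs'
  have hval : (1 / b) ^ 2 * ((c + 1 / b - c)⁻¹ • ∫ x in c..c + 1 / b, ‖h x‖ ^ 2) =
      (1 / b) * ∫ x in Set.Ioc c (c + 1 / b), ‖h x‖ ^ 2 := by
    rw [intervalIntegral.integral_of_le hcb.le, add_sub_cancel_left, smul_eq_mul]
    field_simp
  rw [hval] at hs'
  have hterm (m : ℤ) : ‖∫ x in Set.Ioc c (c + 1 / b),
      Complex.exp (2 * Real.pi * Complex.I * (m * b * x)) * h x‖ₑ ^ 2 =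
      ENNReal.ofReal (((fun i => (1 / b) ^ 2 * ‖fourierCoeffOn hcb h i‖ ^ 2) ∘ Equiv.neg ℤ) m) := by
    rw [hcoeff, ← ofReal_norm, ← ENNReal.ofReal_pow (norm_nonneg _), norm_mul, mul_pow,
      Complex.norm_real, Real.norm_of_nonneg hb'.le]
    rfl
  simp_rw [hterm]
  rw [← ENNReal.ofReal_tsum_of_nonneg (fun m => by simp only [Function.comp]; positivity)
    hs'.summable, hs'.tsum_eq, ENNReal.ofReal_mul hb'.le,
    ofReal_integral_eq_lintegral_ofReal hint (Filter.Eventually.of_forall fun x => by positivity)]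
  simp_rw [ENNReal.ofReal_pow (norm_nonneg _), ofReal_norm]

/-- A piece of the Gabor system whose window lives on an interval of length at most
`min a (1 / b)` satisfies the Bessel bound `M² / b`. -/
lemma tsum_enorm_setIntegral_Ioc_sq_le {a b δ M : ℝ} (hb : 0 < b) (hδa : δ ≤ a)
    (hδb : δ ≤ 1 / b) (c : ℝ) {g : ℝ → ℂ} (hg : Measurable g) (hM : ∀ x, ‖g x‖ ≤ M)
    {f : ℝ → ℂ} (hf : MemLp f 2 volume) :
    ∑' p : ℤ × ℤ, ‖∫ x in Set.Ioc (c + p.2 * a) (c + p.2 * a + δ),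
        Complex.exp (2 * Real.pi * Complex.I * (p.1 * b * x)) *
          (g (x - p.2 * a) * f x)‖ₑ ^ 2 ≤
      ENNReal.ofReal (1 / b * M ^ 2) * ∫⁻ x, ‖f x‖ₑ ^ 2 := by
  have hM0 : 0 ≤ M := (norm_nonneg _).trans (hM 0)
  have hb' : (0 : ℝ) < 1 / b := by positivity
  rw [ENNReal.tsum_prod', ENNReal.tsum_comm]
  have key (n : ℤ) : ∑' m : ℤ, ‖∫ x in Set.Ioc (c + n * a) (c + n * a + δ),
        Complex.exp (2 * Real.pi * Complex.I * (m * b * x)) * (g (x - n * a) * f x)‖ₑ ^ 2 ≤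
      ENNReal.ofReal (1 / b * M ^ 2) *
        ∫⁻ x in Set.Ioc (c + n * a) (c + n * a + a), ‖f x‖ₑ ^ 2 := by
    set S := Set.Ioc (c + n * a) (c + n * a + δ) with hS
    have hSm : MeasurableSet S := measurableSet_Ioc
    have hgf : MemLp (fun x => g (x - n * a) * f x) 2 volume :=
      hf.of_le_mul (c := M)
        ((hg.comp (measurable_id.sub_const _)).aestronglyMeasurable.mul hf.aestronglyMeasurable)
        (Filter.Eventually.of_forall fun x => by
          rw [norm_mul]; exact mul_le_mul_of_nonneg_right (hM _) (norm_nonneg _))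
    have hsub : S ⊆ Set.Ioc (c + n * a) (c + n * a + 1 / b) :=
      Set.Ioc_subset_Ioc_right (by linarith)
    have hsub' : S ⊆ Set.Ioc (c + n * a) (c + n * a + a) :=
      Set.Ioc_subset_Ioc_right (by linarith)
    have h1 := tsum_enorm_integral_exp_mul_sq hb (c + n * a) (hgf.indicator hSm)
    have h2 (m : ℤ) : ∫ x in Set.Ioc (c + n * a) (c + n * a + 1 / b),
        Complex.exp (2 * Real.pi * Complex.I * (m * b * x)) *
          S.indicator (fun x => g (x - n * a) * f x) x =
        ∫ x in S, Complex.exp (2 * Real.pi * Complex.I * (m * b * x)) *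
          (g (x - n * a) * f x) := by
      rw [← Set.inter_eq_right.mpr hsub, ← setIntegral_indicator hSm,
        Set.inter_eq_right.mpr hsub]
      refine integral_congr_ae (Filter.Eventually.of_forall fun x => ?_)
      by_cases hx : x ∈ S <;> simp [hx]
    simp_rw [h2] at h1
    rw [h1, ENNReal.ofReal_mul hb'.le, mul_assoc]
    gcongr
    have h3 (x : ℝ) : ‖S.indicator (fun x => g (x - n * a) * f x) x‖ₑ ^ 2 ≤
        S.indicator (fun x => ENNReal.ofReal (M ^ 2) * ‖f x‖ₑ ^ 2) x := by
      by_cases hx : x ∈ S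
      · simp only [Set.indicator_of_mem hx, enorm_mul, mul_pow, ENNReal.ofReal_pow hM0]
        gcongr
        rw [← ofReal_norm]
        exact ENNReal.ofReal_le_ofReal (hM _)
      · simp [Set.indicator_of_notMem hx]
    calc _ ≤ ∫⁻ x in Set.Ioc (c + n * a) (c + n * a + 1 / b),
          S.indicator (fun x => ENNReal.ofReal (M ^ 2) * ‖f x‖ₑ ^ 2) x := lintegral_mono h3
      _ ≤ ∫⁻ x, S.indicator (fun x => ENNReal.ofReal (M ^ 2) * ‖f x‖ₑ ^ 2) x :=
        setLIntegral_le_lintegral _ _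
      _ = ENNReal.ofReal (M ^ 2) * ∫⁻ x in S, ‖f x‖ₑ ^ 2 := by
        rw [lintegral_indicator hSm, lintegral_const_mul' _ _ ENNReal.ofReal_ne_top]
      _ ≤ _ := by gcongr
  have hdisj : Pairwise (Function.onFun Disjoint
      fun n : ℤ => Set.Ioc (c + n * a) (c + n * a + a)) := by
    simpa [add_smul, zsmul_eq_mul, add_assoc] using
      Set.pairwise_disjoint_Ioc_add_zsmul c a
  calc _ ≤ ∑' n : ℤ, ENNReal.ofReal (1 / b * M ^ 2) *
        ∫⁻ x in Set.Ioc (c + n * a) (c + n * a + a), ‖f x‖ₑ ^ 2 := ENNReal.tsum_le_tsum key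
    _ = ENNReal.ofReal (1 / b * M ^ 2) *
        ∫⁻ x in ⋃ n : ℤ, Set.Ioc (c + n * a) (c + n * a + a), ‖f x‖ₑ ^ 2 := by
      rw [ENNReal.tsum_mul_left, lintegral_iUnion (fun _ => measurableSet_Ioc) hdisj]
    _ ≤ _ := mul_le_mul_right (setLIntegral_le_lintegral _ _) _

lemma enorm_sum_sq_le_card_mul_sum {ι E : Type*} [SeminormedAddCommGroup E] (s : Finset ι)
    (f : ι → E) : ‖∑ i ∈ s, f i‖ₑ ^ 2 ≤ s.card * ∑ i ∈ s, ‖f i‖ₑ ^ 2 := by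
  have h : ‖∑ i ∈ s, f i‖₊ ^ 2 ≤ s.card * ∑ i ∈ s, ‖f i‖₊ ^ 2 :=
    (pow_le_pow_left₀ (by positivity) (nnnorm_sum_le s f) 2).trans sq_sum_le_card_mul_sum_sq
  simp only [enorm_eq_nnnorm]
  exact_mod_cast h

lemma lintegral_enorm_sq_eq_enorm_sq (f : L2R) : ∫⁻ x, ‖f x‖ₑ ^ 2 = ‖f‖ₑ ^ 2 := by
  have h := eLpNorm_nnreal_pow_eq_lintegral (f := f) (μ := volume) (p := 2) two_ne_zero
  rw [Lp.enorm_def]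
  simpa using h.symm

/-- Cutting the support of the window into `K` intervals of length `δ` splits the Gabor
coefficients accordingly. -/
lemma inner_eq_sum_setIntegral_Ioc {g : ℝ → ℂ} {a b c δ : ℝ} (hδ : 0 ≤ δ) {K : ℕ}
    (hg : ∀ x, x ∉ Set.Ioc c (c + K * δ) → g x = 0) {G : ℤ × ℤ → L2R}
    (hG : RepresentsGabor G g a b) (f : L2R) (p : ℤ × ℤ) :
    ⟪f, G p⟫_ℂ = ∑ k ∈ Finset.range K,
      ∫ x in Set.Ioc (c + k * δ + p.2 * a) (c + k * δ + p.2 * a + δ),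
        Complex.exp (2 * Real.pi * Complex.I * (p.1 * b * x)) *
          (g (x - p.2 * a) * star (f x)) := by
  set F : ℝ → ℂ := fun x => Complex.exp (2 * Real.pi * Complex.I * (p.1 * b * x)) *
          (g (x - p.2 * a) * star (f x)) with hF
  have hae : (fun x => ⟪f x, G p x⟫_ℂ) =ᵐ[volume] F := by
    filter_upwards [hG p] with x hx
    rw [hx, RCLike.inner_apply, gaborFun, hF]
    simp only [starRingEnd_apply]
    ring
  have hFi : Integrable F := (L2.integrable_inner f (G p)).congr hae
  rw [L2.inner_def, integral_congr_ae hae]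
  have hsum := intervalIntegral.sum_integral_adjacent_intervals (f := F) (μ := volume)
    (a := fun k : ℕ => c + k * δ + p.2 * a) (n := K) (fun k _ => hFi.intervalIntegrable)
  have hK : (0 : ℝ) ≤ K * δ := by positivity
  rw [intervalIntegral.integral_of_le (by push_cast; linarith)] at hsum
  rw [setIntegral_eq_integral_of_forall_compl_eq_zero] at hsum
  · rw [← hsum]
    refine Finset.sum_congr rfl fun k _ => ?_
    rw [intervalIntegral.integral_of_le (by push_cast; linarith)]
    congr 3
    push_cast
    ring
  · intro x hx
    have : g (x - p.2 * a) = 0 := by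
      refine hg _ fun h => hx ?_
      simp only [Set.mem_Ioc, Nat.cast_zero] at h ⊢
      constructor <;> linarith [h.1, h.2]
    simp [hF, this]

theorem gabor_system_of_bounded_compactly_supported_is_bessel
    (g : ℝ → ℂ) (hmeas : Measurable g) (M : ℝ) (hbd : ∀ x, ‖g x‖ ≤ M)
    (hsupp : HasCompactSupport g)
    (a b : ℝ) (ha : 0 < a) (hb : 0 < b) :
    ∃ B > 0, ∀ G : ℤ × ℤ → L2R, RepresentsGabor G g a b → IsBesselWith G B := by
  obtain ⟨R, hR⟩ := hsupp.isCompact.isBounded.subset_ball 0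
  set δ := min a (1 / b) with hδ
  have hδ0 : 0 < δ := lt_min ha (by positivity)
  obtain ⟨K, hK⟩ := exists_nat_ge (2 * R / δ)
  rw [div_le_iff₀ hδ0] at hK
  have hg (x : ℝ) (hx : x ∉ Set.Ioc (-R) (-R + K * δ)) : g x = 0 := by
    by_contra hne
    have hxR := hR (subset_tsupport g hne)
    rw [Real.ball_eq_Ioo, Set.mem_Ioo] at hxR
    exact hx ⟨by linarith [hxR.1], by linarith [hxR.2]⟩
  set C : ℝ := K * (K * (1 / b * M ^ 2)) with hC
  have hC0 : 0 ≤ C := by positivity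
  refine ⟨C + 1, by positivity, fun G hG f => ?_⟩
  have hfstar : MemLp (fun x => star (f x)) 2 volume := (Lp.memLp f).star
  have hstar (x : ℝ) : ‖star (f x)‖ₑ = ‖f x‖ₑ := by rw [← ofReal_norm, norm_star, ofReal_norm]
  have hofReal : ENNReal.ofReal C = K * (K * ENNReal.ofReal (1 / b * M ^ 2)) := by
    rw [hC, ENNReal.ofReal_mul K.cast_nonneg, ENNReal.ofReal_mul K.cast_nonneg,
      ENNReal.ofReal_natCast]
  have hle : ∑' p, ‖⟪f, G p⟫_ℂ‖ₑ ^ 2 ≤ ENNReal.ofReal C * ‖f‖ₑ ^ 2 := by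
    simp_rw [inner_eq_sum_setIntegral_Ioc hδ0.le hg hG f]
    refine (ENNReal.tsum_le_tsum fun p => enorm_sum_sq_le_card_mul_sum _ _).trans ?_
    rw [ENNReal.tsum_mul_left, Summable.tsum_finsetSum fun _ _ => ENNReal.summable]
    refine (mul_le_mul_right (Finset.sum_le_sum fun (k : ℕ) _ =>
      tsum_enorm_setIntegral_Ioc_sq_le (a := a) (δ := δ) hb (min_le_left _ _) (min_le_right _ _) (-R + k * δ)
        hmeas hbd hfstar) _).trans ?_
    simp only [hstar, lintegral_enorm_sq_eq_enorm_sq, Finset.sum_const, Finset.card_range,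
      nsmul_eq_mul]
    rw [hofReal, mul_assoc, mul_assoc]
  have hnorm (z : ℂ) : ENNReal.ofReal (‖z‖ ^ 2) = ‖z‖ₑ ^ 2 := by
    rw [ENNReal.ofReal_pow (norm_nonneg _), ofReal_norm]
  have hle' : ∑' p, ENNReal.ofReal (‖⟪f, G p⟫_ℂ‖ ^ 2) ≤ ENNReal.ofReal (C * ‖f‖ ^ 2) := by
    simp_rw [hnorm]
    rwa [ENNReal.ofReal_mul hC0, ENNReal.ofReal_pow (norm_nonneg _), ofReal_norm]
  have hs : Summable fun p => ‖⟪f, G p⟫_ℂ‖ ^ 2 :=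
    (ENNReal.summable_toReal (ne_top_of_le_ne_top ENNReal.ofReal_ne_top hle')).congr
      fun p => ENNReal.toReal_ofReal (by positivity)
  refine ⟨hs, ?_⟩
  rw [← ENNReal.ofReal_tsum_of_nonneg (fun _ => by positivity) hs,
    ENNReal.ofReal_le_ofReal_iff (by positivity)] at hle'
  nlinarith [sq_nonneg ‖f‖]
end
end

section
/- Let g ∈ L²(ℝ) and a, b > 0, and let A, B > 0. Then the Gabor system {E_{mb}T_{na}g}_{m,n∈ℤ} is a frame for L²(ℝ) with bounds A, B if and only if the Gabor system {(ab)^{−1/2} E_{m/a}T_{n/b}g}_{m,n∈ℤ} on the dual lattice is a Riesz sequence in L²(ℝ) with bounds A, B. -/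
open scoped InnerProductSpace
open MeasureTheory Complex Real

noncomputable section

/-- `f` is a frame with bounds `A`, `B`. -/
def IsFrameWith {ι : Type*} (f : ι → L2R) (A B : ℝ) : Prop :=
  ∀ x : L2R, Summable (fun i => ‖⟪x, f i⟫_ℂ‖ ^ 2) ∧
    A * ‖x‖ ^ 2 ≤ ∑' i, ‖⟪x, f i⟫_ℂ‖ ^ 2 ∧
    ∑' i, ‖⟪x, f i⟫_ℂ‖ ^ 2 ≤ B * ‖x‖ ^ 2

/-- `f` is a Riesz sequence with bounds `A`, `B`. -/
def IsRieszSeqWith {ι : Type*} (f : ι → L2R) (A B : ℝ) : Prop :=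
  ∀ (s : Finset ι) (c : ι → ℂ),
    A * ∑ i ∈ s, ‖c i‖ ^ 2 ≤ ‖∑ i ∈ s, c i • f i‖ ^ 2 ∧
    ‖∑ i ∈ s, c i • f i‖ ^ 2 ≤ B * ∑ i ∈ s, ‖c i‖ ^ 2

section GaborDuality

open Set Filter Topology ENNReal

section Periodic

variable {T β : ℝ}

/-- The exponential `x ↦ e^{2πimβx}`. -/
def expChar (β : ℝ) (m : ℤ) (x : ℝ) : ℂ := Complex.exp (2 * Real.pi * Complex.I * (m * β * x))

lemma continuous_expChar (β : ℝ) (m : ℤ) : Continuous (expChar β m) := by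
  unfold expChar; fun_prop

lemma norm_expChar (β : ℝ) (m : ℤ) (x : ℝ) : ‖expChar β m x‖ = 1 := by
  have : expChar β m x = Complex.exp ((2 * Real.pi * (m * β * x) : ℝ) * Complex.I) := by
    unfold expChar; congr 1; push_cast; ring
  rw [this, Complex.norm_exp_ofReal_mul_I]

lemma expChar_eq_fourier (hβ : β * T = 1) (m : ℤ) (x : ℝ) :
    expChar β m x = fourier m (x : AddCircle T) := by
  have hT : (T : ℂ) ≠ 0 := by
    rintro h; norm_cast at h; simp [h] at hβ
  have hβ' : (β : ℂ) = 1 / T := by rw [eq_div_iff hT]; exact_mod_cast hβ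
  rw [fourier_coe_apply, expChar, hβ']; congr 1; field_simp

lemma expChar_add_int_mul (hβ : β * T = 1) (m l : ℤ) (x : ℝ) :
    expChar β m (x + l * T) = expChar β m x := by
  rw [expChar_eq_fourier hβ, expChar_eq_fourier hβ]
  congr 1
  rw [AddCircle.coe_add, add_eq_left, AddCircle.coe_eq_zero_iff]
  exact ⟨l, by simp⟩

lemma Lp_enorm_sq_eq_lintegral {X : Type*} [MeasurableSpace X] {μ : Measure X} (x : Lp ℂ 2 μ) :
    ‖x‖ₑ ^ 2 = ∫⁻ y, ‖x y‖ₑ ^ 2 ∂μ := by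
  have := eLpNorm_nnreal_pow_eq_lintegral (μ := μ) (f := (x : X → ℂ)) (p := 2) (by simp)
  rw [Lp.enorm_def]
  simpa using! this

lemma measure_le_of_forall_lintegral_continuousMap_le {X : Type*} [TopologicalSpace X]
    [CompactSpace X] [HasOuterApproxClosed X] [MeasurableSpace X] [BorelSpace X]
    {μ ν : Measure X} [IsFiniteMeasure μ] [IsFiniteMeasure ν] [μ.WeaklyRegular]
    (h : ∀ φ : C(X, ℂ), ∫⁻ x, ‖φ x‖ₑ ^ 2 ∂μ ≤ ∫⁻ x, ‖φ x‖ₑ ^ 2 ∂ν) : μ ≤ ν := by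
  have hclosed : ∀ F : Set X, IsClosed F → μ F ≤ ν F := by
    intro F hF
    refine le_of_tendsto_of_tendsto' (HasOuterApproxClosed.tendsto_lintegral_apprSeq hF μ)
      (HasOuterApproxClosed.tendsto_lintegral_apprSeq hF ν) fun n => ?_
    have h1 := h ⟨fun x => ((NNReal.sqrt (hF.apprSeq n x) : ℝ) : ℂ), by
      have := (hF.apprSeq n).continuous
      fun_prop⟩
    have h2 : ∀ x, ‖((NNReal.sqrt (hF.apprSeq n x) : ℝ) : ℂ)‖ₑ ^ 2
        = (hF.apprSeq n x : ENNReal) := by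
      intro x
      have : ‖((NNReal.sqrt (hF.apprSeq n x) : ℝ) : ℂ)‖₊ = NNReal.sqrt (hF.apprSeq n x) := by
        ext; simp
      rw [enorm_eq_nnnorm, this, ← ENNReal.coe_pow, NNReal.sq_sqrt]
    simpa only [ContinuousMap.coe_mk, h2] using h1
  refine Measure.le_iff.2 fun s hs => ?_
  rw [hs.measure_eq_iSup_isClosed_of_ne_top (measure_ne_top μ s)]
  exact iSup_le fun F => iSup_le fun hFs => iSup_le fun hF =>
    (hclosed F hF).trans (measure_mono hFs)

lemma lintegral_enorm_sq_continuousMap_le_of_topologicalClosure {X : Type*} [TopologicalSpace X]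
    [CompactSpace X] [MeasurableSpace X] [BorelSpace X]
    {μ ν : Measure X} [IsFiniteMeasure μ] [IsFiniteMeasure ν] {V : Submodule ℂ C(X, ℂ)}
    (hV : V.topologicalClosure = ⊤)
    (h : ∀ φ ∈ V, ∫⁻ x, ‖φ x‖ₑ ^ 2 ∂μ ≤ ∫⁻ x, ‖φ x‖ₑ ^ 2 ∂ν) (φ : C(X, ℂ)) :
    ∫⁻ x, ‖φ x‖ₑ ^ 2 ∂μ ≤ ∫⁻ x, ‖φ x‖ₑ ^ 2 ∂ν := by
  have key : ∀ (ρ : Measure X) [IsFiniteMeasure ρ] (ψ : C(X, ℂ)),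
      ∫⁻ x, ‖ψ x‖ₑ ^ 2 ∂ρ = ‖ContinuousMap.toLp (E := ℂ) 2 ρ ℂ ψ‖ₑ ^ 2 := by
    intro ρ _ ψ
    rw [Lp_enorm_sq_eq_lintegral]
    refine lintegral_congr_ae ?_
    filter_upwards [ContinuousMap.coeFn_toLp (p := 2) (𝕜 := ℂ) ρ ψ] with x hx
    rw [hx]
  have hcl : IsClosed {ψ : C(X, ℂ) | ∫⁻ x, ‖ψ x‖ₑ ^ 2 ∂μ ≤ ∫⁻ x, ‖ψ x‖ₑ ^ 2 ∂ν} := by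
    simp only [key]
    refine isClosed_le ?_ ?_ <;>
    · refine (ENNReal.continuous_pow 2).comp (continuous_enorm.comp ?_)
      exact ContinuousLinearMap.continuous _
  have hmem : φ ∈ V.topologicalClosure := hV ▸ Submodule.mem_top
  rw [← SetLike.mem_coe, Submodule.topologicalClosure_coe] at hmem
  exact closure_minimal (fun ψ hψ => h ψ hψ) hcl hmem

lemma ae_le_of_forall_trigPoly_lintegral_le (hT : 0 < T) (hβ : β * T = 1) (t : ℝ)
    {u v : ℝ → ENNReal} (hu : Measurable u) (hv : Measurable v)
    (hu' : ∫⁻ x in Ioc t (t + T), u x ≠ ⊤) (hv' : ∫⁻ x in Ioc t (t + T), v x ≠ ⊤)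
    (h : ∀ (M : Finset ℤ) (c : ℤ → ℂ),
      ∫⁻ x in Ioc t (t + T), ‖∑ m ∈ M, c m * expChar β m x‖ₑ ^ 2 * u x ≤
        ∫⁻ x in Ioc t (t + T), ‖∑ m ∈ M, c m * expChar β m x‖ₑ ^ 2 * v x) :
    ∀ᵐ x ∂volume.restrict (Ioc t (t + T)), u x ≤ v x := by
  have : Fact (0 < T) := ⟨hT⟩
  let q : ℝ → AddCircle T := fun x => x
  have hq : Measurable q := AddCircle.measurable_mk'
  let ρ (w : ℝ → ENNReal) : Measure (AddCircle T) :=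
    ((volume.restrict (Ioc t (t + T))).withDensity w).map q
  have hρ : ∀ w : ℝ → ENNReal, Measurable w → ∀ f : AddCircle T → ENNReal, Measurable f →
      ∫⁻ y, f y ∂(ρ w) = ∫⁻ x in Ioc t (t + T), f x * w x := by
    intro w hw f hf
    rw [lintegral_map hf hq]
    change ∫⁻ x, (f ∘ q) x ∂_ = _
    rw [lintegral_withDensity_eq_lintegral_mul _ hw (hf.comp hq)]
    simp [mul_comm, q]
  have hfin : ∀ w : ℝ → ENNReal, Measurable w → ∫⁻ x in Ioc t (t + T), w x ≠ ⊤ →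
      IsFiniteMeasure (ρ w) := by
    intro w hw h
    have := hρ w hw 1 measurable_one
    refine ⟨?_⟩
    simp only [Pi.one_apply, lintegral_one, one_mul] at this
    rw [this]; exact h.lt_top
  have := hfin u hu hu'
  have := hfin v hv hv'
  have hle : ρ u ≤ ρ v := by
    refine measure_le_of_forall_lintegral_continuousMap_le
      (lintegral_enorm_sq_continuousMap_le_of_topologicalClosure span_fourier_closure_eq_top ?_)
    intro φ hφ
    obtain ⟨c, rfl⟩ := Finsupp.mem_span_range_iff_exists_finsupp.1 hφ
    rw [hρ u hu _ (by fun_prop), hρ v hv _ (by fun_prop)]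
    convert h c.support c using 5 <;>
    · simp [Finsupp.sum, ContinuousMap.sum_apply, expChar_eq_fourier hβ]
  refine ae_le_of_forall_setLIntegral_le_of_sigmaFinite hu fun s hs _ => ?_
  let e := AddCircle.measurableEquivIoc T t
  let s' : Set (AddCircle T) := {y | (e y : ℝ) ∈ s}
  have hs' : MeasurableSet s' := (measurable_subtype_coe.comp e.measurable) hs
  have hpre : ∀ w : ℝ → ENNReal, Measurable w →
      ∫⁻ x in s, w x ∂(volume.restrict (Ioc t (t + T))) = ρ w s' := by
    intro w hw
    rw [← lintegral_indicator_one hs', hρ w hw _ (measurable_one.indicator hs'),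
      ← lintegral_indicator hs]
    refine setLIntegral_congr_fun measurableSet_Ioc fun x hx => ?_
    have hex : (e (x : AddCircle T) : ℝ) = x := AddCircle.equivIoc_coe_of_mem hx
    have hmem : (x : AddCircle T) ∈ s' ↔ x ∈ s := by
      simp only [s', Set.mem_ofPred_eq, hex]
    by_cases hxs : x ∈ s <;> simp [Set.indicator, hmem, hxs]
  rw [hpre u hu, hpre v hv]
  exact hle s'

end Periodic

section Parseval

variable {T β : ℝ}

lemma lintegral_Ioc_enorm_sq_trigPoly (hT : 0 < T) (hβ : β * T = 1) (t : ℝ) (M : Finset ℤ)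
    (c : ℤ → ℂ) :
    ∫⁻ x in Ioc t (t + T), ‖∑ m ∈ M, c m * expChar β m x‖ₑ ^ 2
      = ENNReal.ofReal T * ∑ m ∈ M, ‖c m‖ₑ ^ 2 := by
  have : Fact (0 < T) := ⟨hT⟩
  have h1 : ∫⁻ x in Ioc t (t + T), ‖∑ m ∈ M, c m * expChar β m x‖ₑ ^ 2
      = ∫⁻ y : AddCircle T, ‖∑ m ∈ M, c m * fourier m y‖ₑ ^ 2 := by
    rw [← AddCircle.lintegral_preimage T t]
    simp only [expChar_eq_fourier hβ]
  rw [h1, AddCircle.volume_eq_smul_haarAddCircle, lintegral_smul_measure, smul_eq_mul]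
  congr 1
  have h2 : ∫⁻ y : AddCircle T, ‖∑ m ∈ M, c m * fourier m y‖ₑ ^ 2 ∂AddCircle.haarAddCircle
      = ‖∑ m ∈ M, c m • fourierLp (T := T) 2 m‖ₑ ^ 2 := by
    rw [Lp_enorm_sq_eq_lintegral]
    refine lintegral_congr_ae ?_
    have h3 : ∀ᵐ y ∂(AddCircle.haarAddCircle (T := T)), ∀ m : ℤ,
        (fourierLp (T := T) 2 m : AddCircle T → ℂ) y = fourier m y :=
      ae_all_iff.2 fun m => coeFn_fourierLp 2 m
    have h4 : ∀ᵐ y ∂(AddCircle.haarAddCircle (T := T)), ∀ m : ℤ,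
        ((c m • fourierLp (T := T) 2 m : Lp ℂ 2 _) : AddCircle T → ℂ) y
          = c m • (fourierLp (T := T) 2 m : AddCircle T → ℂ) y :=
      ae_all_iff.2 fun m => Lp.coeFn_smul _ _
    filter_upwards [h3, h4, Lp.coeFn_finsetSum M (fun m => c m • fourierLp (T := T) 2 m)]
      with y h3 h4 h5
    rw [h5, Finset.sum_apply]
    simp only [h4, h3, smul_eq_mul]
  rw [h2]
  have h3 : ‖∑ m ∈ M, c m • fourierLp (T := T) 2 m‖ ^ 2 = ∑ m ∈ M, ‖c m‖ ^ 2 := by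
    have := orthonormal_fourier (T := T) |>.inner_sum c c M
    rw [inner_self_eq_norm_sq_to_K] at this
    have h4 : ∀ m, (starRingEnd ℂ) (c m) * c m = ((‖c m‖ ^ 2 : ℝ) : ℂ) := by
      intro m; rw [Complex.conj_mul']; simp
    simp only [h4] at this
    push_cast at this
    exact Complex.ofReal_injective (by push_cast; exact this)
  simp only [← ofReal_norm, ← ENNReal.ofReal_pow (norm_nonneg _)]
  rw [h3, ENNReal.ofReal_sum_of_nonneg fun _ _ => by positivity]

lemma tsum_enorm_sq_integral_expChar_mul (hT : 0 < T) (hβ : β * T = 1) (t : ℝ) {F : ℝ → ℂ}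
    (hF : MemLp F 2 (volume.restrict (Ioc t (t + T)))) :
    ∑' m : ℤ, ‖∫ x in Ioc t (t + T), expChar β m x * F x‖ₑ ^ 2
      = ENNReal.ofReal T * ∫⁻ x in Ioc t (t + T), ‖F x‖ₑ ^ 2 := by
  have hab : t < t + T := by linarith
  have hs := hasSum_sq_fourierCoeffOn hab hF
  have hβT : β * (t + T - t) = 1 := by simpa using hβ
  have hc : ∀ m : ℤ, ‖∫ x in Ioc t (t + T), expChar β m x * F x‖ ^ 2
      = T ^ 2 * ‖fourierCoeffOn hab F (-m)‖ ^ 2 := by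
    intro m
    rw [fourierCoeffOn_eq_integral, intervalIntegral.integral_of_le hab.le, norm_smul, neg_neg]
    simp only [expChar_eq_fourier hβT, smul_eq_mul, add_sub_cancel_left, mul_pow, Real.norm_eq_abs,
      sq_abs]
    field_simp
  have hs' : HasSum (fun m : ℤ => ‖∫ x in Ioc t (t + T), expChar β m x * F x‖ ^ 2)
      (T * ∫ x in Ioc t (t + T), ‖F x‖ ^ 2) := by
    have := ((Equiv.neg ℤ).hasSum_iff.2 hs).mul_left (T ^ 2)
    simp only [Function.comp_apply, Equiv.neg_apply, add_sub_cancel_left, smul_eq_mul] at this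
    simp only [hc]
    rw [intervalIntegral.integral_of_le hab.le] at this
    rwa [show T * ∫ x in Ioc t (t + T), ‖F x‖ ^ 2
      = T ^ 2 * (T⁻¹ * ∫ x in Ioc t (t + T), ‖F x‖ ^ 2) by field_simp]
  simp only [← ofReal_norm, ← ENNReal.ofReal_pow (norm_nonneg _)]
  rw [← ENNReal.ofReal_tsum_of_nonneg (fun _ => by positivity) hs'.summable, hs'.tsum_eq,
    ENNReal.ofReal_mul hT.le, ofReal_integral_eq_lintegral_ofReal]
  · exact hF.integrable_norm_pow two_ne_zero
  · exact Eventually.of_forall fun _ => by positivity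

end Parseval

section Periodization

variable {T : ℝ}

lemma iUnion_Ioc_sub_int_mul (hT : 0 < T) (t : ℝ) :
    ⋃ k : ℤ, (fun x => x + k * T) ⁻¹' Ioc t (t + T) = univ := by
  refine eq_univ_of_forall fun y => ?_
  obtain ⟨k, hk, -⟩ := existsUnique_add_zsmul_mem_Ioc hT y t
  exact mem_iUnion.2 ⟨k, by rwa [zsmul_eq_mul] at hk⟩

lemma eq_of_add_int_mul_mem_Ioc (hT : 0 < T) {t x : ℝ} {k l : ℤ}
    (hk : x + k * T ∈ Ioc t (t + T)) (hl : x + l * T ∈ Ioc t (t + T)) : k = l :=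
  (existsUnique_add_zsmul_mem_Ioc hT x t).unique (by simpa using hk) (by simpa using hl)

lemma pairwise_disjoint_preimage_Ioc (hT : 0 < T) (t : ℝ) :
    Pairwise (Function.onFun Disjoint
      fun k : ℤ => (fun x : ℝ => x + k * T) ⁻¹' Ioc t (t + T)) := fun _ _ hkl =>
  Set.disjoint_left.2 fun _ hk hl => hkl (eq_of_add_int_mul_mem_Ioc hT hk hl)

lemma lintegral_eq_lintegral_Ioc_tsum_sub (hT : 0 < T) (t : ℝ) {h : ℝ → ENNReal}
    (hm : Measurable h) :
    ∫⁻ x, h x = ∫⁻ x in Ioc t (t + T), ∑' k : ℤ, h (x - k * T) := by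
  rw [lintegral_tsum fun k => by fun_prop, ← setLIntegral_univ, ← iUnion_Ioc_sub_int_mul hT t,
    lintegral_iUnion (fun k => measurableSet_Ioc.preimage (by fun_prop))
      (pairwise_disjoint_preimage_Ioc hT t)]
  refine tsum_congr fun k => ?_
  have := (measurePreserving_add_right volume ((k : ℝ) * T)).setLIntegral_comp_preimage
    (measurableSet_Ioc (a := t) (b := t + T)) (f := fun x => h (x - k * T)) (by fun_prop)
  simpa using this

lemma lintegral_eq_lintegral_Ioc_tsum_add (hT : 0 < T) (t : ℝ) {h : ℝ → ENNReal}
    (hm : Measurable h) :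
    ∫⁻ x, h x = ∫⁻ x in Ioc t (t + T), ∑' k : ℤ, h (x + k * T) := by
  rw [lintegral_eq_lintegral_Ioc_tsum_sub hT t hm]
  refine lintegral_congr fun x => ?_
  rw [← (Equiv.neg ℤ).tsum_eq]
  simp

lemma integral_eq_integral_Ioc_sum_sub (hT : 0 < T) (t : ℝ) {h : ℝ → ℂ} (hi : Integrable h)
    {K : Finset ℤ} (hK : ∀ x ∈ Ioc t (t + T), ∀ k ∉ K, h (x - k * T) = 0) :
    ∫ x, h x = ∫ x in Ioc t (t + T), ∑ k ∈ K, h (x - k * T) := by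
  have hpre : ∀ k : ℤ, ∫ x in (fun x => x + k * T) ⁻¹' Ioc t (t + T), h x
      = ∫ x in Ioc t (t + T), h (x - k * T) := by
    intro k
    have := (measurePreserving_add_right volume ((k : ℝ) * T)).setIntegral_preimage_emb
      (measurableEmbedding_addRight _) (fun x => h (x - k * T)) (Ioc t (t + T))
    simpa using this
  rw [integral_finsetSum _ fun k _ => (hi.comp_sub_right _).integrableOn, ← setIntegral_univ,
    ← iUnion_Ioc_sub_int_mul hT t,
    integral_iUnion (fun k => measurableSet_Ioc.preimage (by fun_prop))
      (pairwise_disjoint_preimage_Ioc hT t) hi.integrableOn]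
  simp only [hpre]
  exact tsum_eq_sum fun k hk =>
    setIntegral_eq_zero_of_forall_eq_zero fun x hx => hK x hx k hk

lemma ae_of_forall_ae_Ioc (hT : 0 < T) {P : ℝ → Prop}
    (h : ∀ t, ∀ᵐ x ∂volume.restrict (Ioc t (t + T)), P x) : ∀ᵐ x, P x := by
  have hU := iUnion_Ioc_add_zsmul hT 0
  rw [← Measure.restrict_univ (μ := (volume : Measure ℝ)), ← hU, ae_restrict_iUnion_iff]
  intro n
  have := h (0 + n • T)
  rwa [add_assoc, ← add_one_zsmul] at this

end Periodization

section SquareSums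

lemma tsum_enorm_sq_eq_ofReal {ι : Type*} {z : ι → ℂ} (h : Summable fun i => ‖z i‖ ^ 2) :
    ∑' i, ‖z i‖ₑ ^ 2 = ENNReal.ofReal (∑' i, ‖z i‖ ^ 2) := by
  simp only [← ofReal_norm, ← ENNReal.ofReal_pow (norm_nonneg _)]
  rw [ENNReal.ofReal_tsum_of_nonneg (fun _ => by positivity) h]

lemma summable_norm_sq_of_tsum_enorm_sq_ne_top {ι : Type*} {z : ι → ℂ}
    (h : ∑' i, ‖z i‖ₑ ^ 2 ≠ ⊤) : Summable fun i => ‖z i‖ ^ 2 := by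
  simpa using ENNReal.summable_toReal h

lemma memℓp_two_of_tsum_enorm_sq_ne_top {ι : Type*} {z : ι → ℂ}
    (h : ∑' i, ‖z i‖ₑ ^ 2 ≠ ⊤) : Memℓp z 2 :=
  (memℓp_gen_iff (by simp)).2 (by simpa using summable_norm_sq_of_tsum_enorm_sq_ne_top h)

lemma lp_enorm_sq_eq_tsum {ι : Type*} (v : lp (fun _ : ι => ℂ) 2) :
    ‖v‖ₑ ^ 2 = ∑' i, ‖v i‖ₑ ^ 2 := by
  have h := lp.hasSum_norm (p := 2) (by simp) v
  simp only [ENNReal.toReal_ofNat, Real.rpow_ofNat] at h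
  rw [tsum_enorm_sq_eq_ofReal h.summable, h.tsum_eq, ← ofReal_norm,
    ENNReal.ofReal_pow (norm_nonneg _)]

lemma isFrameWith_iff_enorm {ι : Type*} {f : ι → L2R} {A B : ℝ} (hA : 0 ≤ A) (hB : 0 ≤ B) :
    IsFrameWith f A B ↔ ∀ x : L2R,
      ENNReal.ofReal A * ‖x‖ₑ ^ 2 ≤ ∑' i, ‖⟪x, f i⟫_ℂ‖ₑ ^ 2 ∧
        ∑' i, ‖⟪x, f i⟫_ℂ‖ₑ ^ 2 ≤ ENNReal.ofReal B * ‖x‖ₑ ^ 2 := by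
  have hx : ∀ (C : ℝ) (x : L2R), 0 ≤ C →
      ENNReal.ofReal C * ‖x‖ₑ ^ 2 = ENNReal.ofReal (C * ‖x‖ ^ 2) := fun C x hC => by
    rw [ENNReal.ofReal_mul hC, ENNReal.ofReal_pow (norm_nonneg _), ofReal_norm]
  refine forall_congr' fun x => ?_
  rw [hx A x hA, hx B x hB]
  constructor
  · rintro ⟨hs, h1, h2⟩
    rw [tsum_enorm_sq_eq_ofReal hs]
    exact ⟨ENNReal.ofReal_le_ofReal h1, ENNReal.ofReal_le_ofReal h2⟩
  · rintro ⟨h1, h2⟩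
    have hs := summable_norm_sq_of_tsum_enorm_sq_ne_top
      (ne_top_of_le_ne_top ENNReal.ofReal_ne_top h2)
    rw [tsum_enorm_sq_eq_ofReal hs] at h1 h2
    exact ⟨hs, (ENNReal.ofReal_le_ofReal_iff (tsum_nonneg fun _ => by positivity)).1 h1,
      (ENNReal.ofReal_le_ofReal_iff (by positivity)).1 h2⟩

lemma isRieszSeqWith_iff_enorm {ι : Type*} {f : ι → L2R} {A B : ℝ} (hA : 0 ≤ A) (hB : 0 ≤ B) :
    IsRieszSeqWith f A B ↔ ∀ (s : Finset ι) (c : ι → ℂ),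
      ENNReal.ofReal A * ∑ i ∈ s, ‖c i‖ₑ ^ 2 ≤ ‖∑ i ∈ s, c i • f i‖ₑ ^ 2 ∧
        ‖∑ i ∈ s, c i • f i‖ₑ ^ 2 ≤ ENNReal.ofReal B * ∑ i ∈ s, ‖c i‖ₑ ^ 2 := by
  refine forall_congr' fun s => forall_congr' fun c => ?_
  simp only [← ofReal_norm, ← ENNReal.ofReal_pow (norm_nonneg _)]
  rw [← ENNReal.ofReal_sum_of_nonneg fun _ _ => by positivity, ← ENNReal.ofReal_mul hA,
    ← ENNReal.ofReal_mul hB, ENNReal.ofReal_le_ofReal_iff (by positivity),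
    ENNReal.ofReal_le_ofReal_iff (mul_nonneg hB (Finset.sum_nonneg fun _ _ => by positivity))]

lemma isRieszSeqWith_of_product {f : ℤ × ℤ → L2R} {A B : ℝ} (hA : 0 ≤ A) (hB : 0 ≤ B)
    (h : ∀ (M K : Finset ℤ) (c : ℤ × ℤ → ℂ),
      ENNReal.ofReal A * ∑ i ∈ M ×ˢ K, ‖c i‖ₑ ^ 2 ≤ ‖∑ i ∈ M ×ˢ K, c i • f i‖ₑ ^ 2 ∧
        ‖∑ i ∈ M ×ˢ K, c i • f i‖ₑ ^ 2 ≤ ENNReal.ofReal B * ∑ i ∈ M ×ˢ K, ‖c i‖ₑ ^ 2) :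
    IsRieszSeqWith f A B := by
  classical
  rw [isRieszSeqWith_iff_enorm hA hB]
  intro s c
  have hs : s ⊆ s.image Prod.fst ×ˢ s.image Prod.snd := Finset.subset_product
  have := h (s.image Prod.fst) (s.image Prod.snd) (fun i => if i ∈ s then c i else 0)
  rw [← Finset.sum_subset hs (fun i _ hi => by simp [hi]),
    ← Finset.sum_subset hs (fun i _ hi => by simp [hi])] at this
  rwa [Finset.sum_congr rfl (fun i hi => by simp [hi] :
      ∀ i ∈ s, ‖if i ∈ s then c i else 0‖ₑ ^ 2 = ‖c i‖ₑ ^ 2),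
    Finset.sum_congr rfl (fun i hi => by simp [hi] :
      ∀ i ∈ s, (if i ∈ s then c i else 0) • f i = c i • f i)] at this

lemma frame_bounds_of_dense {ι : Type*} {f : ι → L2R} {A B : ℝ} {D : Set L2R} (hD : Dense D)
    (h : ∀ x ∈ D, ENNReal.ofReal A * ‖x‖ₑ ^ 2 ≤ ∑' i, ‖⟪x, f i⟫_ℂ‖ₑ ^ 2 ∧
      ∑' i, ‖⟪x, f i⟫_ℂ‖ₑ ^ 2 ≤ ENNReal.ofReal B * ‖x‖ₑ ^ 2) (x : L2R) :
    ENNReal.ofReal A * ‖x‖ₑ ^ 2 ≤ ∑' i, ‖⟪x, f i⟫_ℂ‖ₑ ^ 2 ∧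
      ∑' i, ‖⟪x, f i⟫_ℂ‖ₑ ^ 2 ≤ ENNReal.ofReal B * ‖x‖ₑ ^ 2 := by
  have hcont : ∀ C : ℝ, Continuous fun x : L2R => ENNReal.ofReal C * ‖x‖ₑ ^ 2 := fun C =>
    (ENNReal.continuous_const_mul ENNReal.ofReal_ne_top).comp
      ((ENNReal.continuous_pow 2).comp continuous_enorm)
  have hupper : ∀ x : L2R, ∑' i, ‖⟪x, f i⟫_ℂ‖ₑ ^ 2 ≤ ENNReal.ofReal B * ‖x‖ₑ ^ 2 := by
    intro x
    rw [ENNReal.tsum_eq_iSup_sum]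
    refine iSup_le fun s => ?_
    have hcl : IsClosed {x : L2R | ∑ i ∈ s, ‖⟪x, f i⟫_ℂ‖ₑ ^ 2 ≤ ENNReal.ofReal B * ‖x‖ₑ ^ 2} := by
      refine isClosed_le (continuous_finsetSum _ fun i _ => ?_) (hcont B)
      exact (ENNReal.continuous_pow 2).comp (by fun_prop)
    exact closure_minimal (fun y hy => (ENNReal.sum_le_tsum s).trans (h y hy).2) hcl (hD x)
  refine ⟨?_, hupper x⟩
  have hsym : ∀ x i, ‖⟪x, f i⟫_ℂ‖ₑ = ‖⟪f i, x⟫_ℂ‖ₑ := fun x i => by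
    rw [← ofReal_norm, norm_inner_symm, ofReal_norm]
  simp only [hsym] at hupper h ⊢
  have hmem : ∀ x : L2R, Memℓp (fun i => ⟪f i, x⟫_ℂ) 2 := fun x =>
    memℓp_two_of_tsum_enorm_sq_ne_top (ne_top_of_le_ne_top
      (ENNReal.mul_ne_top ENNReal.ofReal_ne_top (by simp)) (hupper x))
  let L : L2R →ₗ[ℂ] lp (fun _ : ι => ℂ) 2 :=
    { toFun := fun x => ⟨_, hmem x⟩
      map_add' := fun x y => by ext i; exact inner_add_right _ _ _
      map_smul' := fun c x => by ext i; exact inner_smul_right _ _ _ }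
  have hL : ∀ x, ‖L x‖ₑ ^ 2 = ∑' i, ‖⟪f i, x⟫_ℂ‖ₑ ^ 2 := fun x => lp_enorm_sq_eq_tsum (L x)
  have hLc : Continuous L := by
    refine AddMonoidHomClass.continuous_of_bound L (Real.sqrt B) fun x => ?_
    have h1 := hupper x
    rw [← hL] at h1
    simp only [← ofReal_norm, ← ENNReal.ofReal_pow (norm_nonneg _)] at h1
    rw [← ENNReal.ofReal_mul' (by positivity)] at h1
    refine le_of_sq_le_sq ?_ (by positivity)
    rw [mul_pow]
    rcases le_total 0 B with hB | hB
    · rw [Real.sq_sqrt hB]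
      exact (ENNReal.ofReal_le_ofReal_iff (by positivity)).1 h1
    · rw [ENNReal.ofReal_of_nonpos (mul_nonpos_of_nonpos_of_nonneg hB (by positivity))] at h1
      have := ENNReal.ofReal_eq_zero.1 (le_antisymm h1 zero_le)
      exact this.trans (by positivity)
  have hcl : IsClosed {x : L2R | ENNReal.ofReal A * ‖x‖ₑ ^ 2 ≤ ∑' i, ‖⟪f i, x⟫_ℂ‖ₑ ^ 2} := by
    simp only [← hL]
    exact isClosed_le (hcont A) ((ENNReal.continuous_pow 2).comp (continuous_enorm.comp hLc))
  exact closure_minimal (fun y hy => (h y hy).1) hcl (hD x)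

end SquareSums

section Fiber

/-- The sum `∑_l |∑_{k ∈ K} d_k g(x + la - ks)|²`, that is the quadratic form of the Ron–Shen
fiber matrix of `g` at `x` on the finitely supported sequence `d`. -/
def fiberSum (g : ℝ → ℂ) (a s : ℝ) (K : Finset ℤ) (d : ℤ → ℂ) (x : ℝ) : ENNReal :=
  ∑' l : ℤ, ‖∑ k ∈ K, d k * g (x + l * a - k * s)‖ₑ ^ 2

variable {g : ℝ → ℂ} {a s : ℝ}

lemma measurable_fiberSum_comp (hg : Measurable g) (K : Finset ℤ) {d : ℝ → ℤ → ℂ}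
    (hd : ∀ k, Measurable fun x => d x k) :
    Measurable fun x => fiberSum g a s K (d x) x := by
  unfold fiberSum
  fun_prop

lemma fiberSum_mul_left (K : Finset ℤ) (z : ℂ) (d : ℤ → ℂ) (x : ℝ) :
    fiberSum g a s K (fun k => z * d k) x = ‖z‖ₑ ^ 2 * fiberSum g a s K d x := by
  unfold fiberSum
  rw [← ENNReal.tsum_mul_left]
  refine tsum_congr fun l => ?_
  simp only [mul_assoc]
  rw [← Finset.mul_sum, enorm_mul, mul_pow]

/-- The quadratic forms of the fiber matrices of `g` lie between `α` and `γ` times the square of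
the `ℓ²` norm. -/
def FiberBounds (g : ℝ → ℂ) (a s : ℝ) (α γ : ENNReal) : Prop :=
  ∀ (K : Finset ℤ) (d : ℤ → ℂ), ∀ᵐ x : ℝ,
    α * ∑ k ∈ K, ‖d k‖ₑ ^ 2 ≤ fiberSum g a s K d x ∧
      fiberSum g a s K d x ≤ γ * ∑ k ∈ K, ‖d k‖ₑ ^ 2

lemma FiberBounds.ae_forall {α γ : ENNReal} (h : FiberBounds g a s α γ) (hα : α ≠ ⊤) (hγ : γ ≠ ⊤)
    (K : Finset ℤ) : ∀ᵐ x : ℝ, ∀ d : ℤ → ℂ,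
      α * ∑ k ∈ K, ‖d k‖ₑ ^ 2 ≤ fiberSum g a s K d x ∧
        fiberSum g a s K d x ≤ γ * ∑ k ∈ K, ‖d k‖ₑ ^ 2 := by
  have h1 : ∀ᵐ x : ℝ, ∀ n : ℕ, _ :=
    ae_all_iff.2 fun n => h K (TopologicalSpace.denseSeq (ℤ → ℂ) n)
  have h2 : ∀ᵐ x : ℝ, ∀ k : ℤ, _ := ae_all_iff.2 fun k => h {k} (fun _ => 1)
  filter_upwards [h1, h2] with x h1 h2
  have hmem : ∀ k : ℤ, Memℓp (fun l : ℤ => g (x + l * a - k * s)) 2 := fun k =>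
    memℓp_two_of_tsum_enorm_sq_ne_top (by
      have := ne_top_of_le_ne_top (by simpa using hγ) (h2 k).2
      simpa [fiberSum] using this)
  let v : ℤ → lp (fun _ : ℤ => ℂ) 2 := fun k => ⟨_, hmem k⟩
  have hv : ∀ d, fiberSum g a s K d x = ‖∑ k ∈ K, d k • v k‖ₑ ^ 2 := by
    intro d
    rw [lp_enorm_sq_eq_tsum]
    refine tsum_congr fun l => ?_
    rw [lp.coeFn_sum, Finset.sum_apply]
    rfl
  have hcont : Continuous fun d => fiberSum g a s K d x := by
    simp only [hv]
    exact (ENNReal.continuous_pow 2).comp (by fun_prop)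
  have hcont' : ∀ C : ENNReal, C ≠ ⊤ → Continuous fun d : ℤ → ℂ => C * ∑ k ∈ K, ‖d k‖ₑ ^ 2 :=
    fun C hC => (ENNReal.continuous_const_mul hC).comp
      (continuous_finsetSum _ fun k _ => (ENNReal.continuous_pow 2).comp (by fun_prop))
  have hcl : IsClosed {d : ℤ → ℂ | α * ∑ k ∈ K, ‖d k‖ₑ ^ 2 ≤ fiberSum g a s K d x ∧
      fiberSum g a s K d x ≤ γ * ∑ k ∈ K, ‖d k‖ₑ ^ 2} :=
    (isClosed_le (hcont' α hα) hcont).inter (isClosed_le hcont (hcont' γ hγ))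
  intro d
  refine closure_minimal ?_ hcl (TopologicalSpace.denseRange_denseSeq (ℤ → ℂ) d)
  rintro _ ⟨n, rfl⟩
  exact h1 n

end Fiber

section FrameSide

variable {g : ℝ → ℂ} {a b s : ℝ}

lemma enorm_sq_eq_lintegral_Ioc_sum (hs : 0 < s) (t : ℝ) {f : ℝ → ℂ} (hf : Measurable f)
    {K : Finset ℤ} (hK : ∀ x ∈ Ioc t (t + s), ∀ k ∉ K, f (x - k * s) = 0)
    {X : L2R} (hX : X =ᵐ[volume] f) :
    ‖X‖ₑ ^ 2 = ∫⁻ x in Ioc t (t + s), ∑ k ∈ K, ‖f (x - k * s)‖ₑ ^ 2 := by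
  rw [Lp_enorm_sq_eq_lintegral, lintegral_congr_ae (hX.mono fun x hx => by rw [hx]),
    lintegral_eq_lintegral_Ioc_tsum_sub hs t (by fun_prop)]
  refine setLIntegral_congr_fun measurableSet_Ioc fun x hx => ?_
  exact tsum_eq_sum fun k hk => by simp [hK x hx k hk]

lemma inner_gabor_eq_integral_Ioc (hs : 0 < s) (hbs : b * s = 1) (t : ℝ)
    {f : ℝ → ℂ} {K : Finset ℤ} (hK : ∀ x ∈ Ioc t (t + s), ∀ k ∉ K, f (x - k * s) = 0)
    {X Y : L2R} (hX : X =ᵐ[volume] f) {m n : ℤ} (hY : Y =ᵐ[volume] gaborFun g a b m n) :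
    ⟪X, Y⟫_ℂ = ∫ x in Ioc t (t + s), expChar b m x *
      ∑ k ∈ K, (starRingEnd ℂ) (f (x - k * s)) * g (x - n * a - k * s) := by
  have hae : (fun x => ⟪X x, Y x⟫_ℂ) =ᵐ[volume]
      fun x => (starRingEnd ℂ) (f x) * (expChar b m x * g (x - n * a)) := by
    filter_upwards [hX, hY] with x hx hy
    rw [hx, hy, RCLike.inner_apply, mul_comm]
    rfl
  rw [L2.inner_def, integral_congr_ae hae, integral_eq_integral_Ioc_sum_sub hs t
    ((L2.integrable_inner X Y).congr hae) fun x hx k hk => by simp [hK x hx k hk]]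
  congr 1 with x
  rw [Finset.mul_sum]
  refine Finset.sum_congr rfl fun k _ => ?_
  have h1 : expChar b m (x - k * s) = expChar b m x := by
    simpa [sub_eq_add_neg] using expChar_add_int_mul hbs m (-k) x
  rw [h1, sub_right_comm]
  ring

lemma memLp_sum_mul_translate (hg : MemLp g 2) {f : ℝ → ℂ} (hf : Measurable f) {C : ℝ}
    (hC : ∀ x, ‖f x‖ ≤ C) (K : Finset ℤ) (u : ℝ) :
    MemLp (fun x => ∑ k ∈ K, (starRingEnd ℂ) (f (x - k * s)) * g (x - u - k * s)) 2 := by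
  refine memLp_finsetSum _ fun k _ => ?_
  have h1 : MemLp (fun x => g (x - u - k * s)) 2 := by
    have := hg.comp_measurePreserving (measurePreserving_sub_right volume (u + k * s))
    simpa [Function.comp_def, sub_sub] using this
  have h2 : MemLp (fun x => (starRingEnd ℂ) (f (x - k * s))) ⊤ := by
    have : Measurable fun x => (starRingEnd ℂ) (f (x - k * s)) := by fun_prop
    exact memLp_top_of_bound this.aestronglyMeasurable C (Eventually.of_forall fun x => by
      simpa using hC _)
  exact h1.mul h2

lemma tsum_enorm_inner_gabor (hs : 0 < s) (hbs : b * s = 1) (t : ℝ) (hgm : Measurable g)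
    (hg : MemLp g 2)
    {G : ℤ × ℤ → L2R} (hG : RepresentsGabor G g a b) {f : ℝ → ℂ} (hf : Measurable f) {C : ℝ}
    (hC : ∀ x, ‖f x‖ ≤ C) {K : Finset ℤ}
    (hK : ∀ x ∈ Ioc t (t + s), ∀ k ∉ K, f (x - k * s) = 0) {X : L2R} (hX : X =ᵐ[volume] f) :
    ∑' p, ‖⟪X, G p⟫_ℂ‖ₑ ^ 2 = ENNReal.ofReal s * ∫⁻ x in Ioc t (t + s),
      fiberSum g a s K (fun k => (starRingEnd ℂ) (f (x - k * s))) x := by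
  rw [ENNReal.tsum_prod', ENNReal.tsum_comm]
  have h1 : ∀ n : ℤ, ∑' m : ℤ, ‖⟪X, G (m, n)⟫_ℂ‖ₑ ^ 2 = ENNReal.ofReal s *
      ∫⁻ x in Ioc t (t + s),
        ‖∑ k ∈ K, (starRingEnd ℂ) (f (x - k * s)) * g (x - n * a - k * s)‖ₑ ^ 2 := by
    intro n
    rw [← tsum_enorm_sq_integral_expChar_mul hs hbs t
      ((memLp_sum_mul_translate hg hf hC K _).restrict _)]
    exact tsum_congr fun m => by rw [inner_gabor_eq_integral_Ioc hs hbs t hK hX (hG (m, n))]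
  simp only [h1]
  rw [ENNReal.tsum_mul_left, ← lintegral_tsum fun n => by fun_prop]
  congr 1
  refine lintegral_congr fun x => ?_
  rw [fiberSum, ← (Equiv.neg ℤ).tsum_eq]
  simp [sub_eq_add_neg]

lemma exists_sub_int_mul_eq_zero_of_hasCompactSupport (hs : 0 < s) (t : ℝ) {f : ℝ → ℂ}
    (hf : HasCompactSupport f) :
    ∃ K : Finset ℤ, ∀ x ∈ Ioc t (t + s), ∀ k ∉ K, f (x - k * s) = 0 := by
  obtain ⟨R, hR⟩ := hf.isCompact.isBounded.subset_closedBall 0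
  refine ⟨Finset.Icc ⌊(t - R) / s⌋ ⌈(t + s + R) / s⌉, fun x hx k hk => ?_⟩
  by_contra hne
  have := hR (subset_tsupport f hne)
  rw [Metric.mem_closedBall, dist_zero_right, Real.norm_eq_abs, abs_le] at this
  refine hk (Finset.mem_Icc.2 ⟨?_, ?_⟩)
  · rw [← Int.cast_le (R := ℝ)]
    refine (Int.floor_le _).trans ?_
    rw [div_le_iff₀ hs]; linarith [hx.1]
  · rw [← Int.cast_le (R := ℝ)]
    refine le_trans ?_ (Int.le_ceil _)
    rw [le_div_iff₀ hs]; linarith [hx.2]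

lemma dense_setOf_ae_eq_continuous_hasCompactSupport :
    Dense {X : L2R | ∃ f : ℝ → ℂ, Continuous f ∧ HasCompactSupport f ∧ X =ᵐ[volume] f} := by
  intro X
  rw [EMetric.mem_closure_iff]
  intro ε hε
  obtain ⟨δ, hδ, hδε⟩ := exists_between hε
  obtain ⟨f, hfs, hle, hfc, hfm⟩ :=
    (Lp.memLp X).exists_hasCompactSupport_eLpNorm_sub_le (by simp) hδ.ne'
  refine ⟨hfm.toLp f, ⟨f, hfc, hfs, hfm.coeFn_toLp⟩, ?_⟩
  rw [Lp.edist_def]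
  refine lt_of_le_of_lt (le_of_eq_of_le (eLpNorm_congr_ae ?_) hle) hδε
  exact (Filter.EventuallyEq.refl _ _).sub hfm.coeFn_toLp

variable {A B : ℝ}

lemma FiberBounds.isFrameWith (hs : 0 < s) (hbs : b * s = 1) (hA : 0 ≤ A) (hB : 0 ≤ B)
    (hgm : Measurable g) (hg : MemLp g 2) {G : ℤ × ℤ → L2R} (hG : RepresentsGabor G g a b)
    (h : FiberBounds g a s (ENNReal.ofReal (A * b)) (ENNReal.ofReal (B * b))) :
    IsFrameWith G A B := by
  rw [isFrameWith_iff_enorm hA hB]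
  refine frame_bounds_of_dense dense_setOf_ae_eq_continuous_hasCompactSupport ?_
  rintro X ⟨f, hfc, hfs, hX⟩
  obtain ⟨K, hK⟩ := exists_sub_int_mul_eq_zero_of_hasCompactSupport hs 0 hfs
  obtain ⟨C, hC⟩ := hfs.exists_bound_of_continuous hfc
  rw [tsum_enorm_inner_gabor hs hbs 0 hgm hg hG hfc.measurable hC hK hX,
    enorm_sq_eq_lintegral_Ioc_sum hs 0 hfc.measurable hK hX]
  have hconst : ∀ D : ℝ, ENNReal.ofReal D = ENNReal.ofReal s * ENNReal.ofReal (D * b) := by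
    intro D
    rw [← ENNReal.ofReal_mul hs.le, mul_comm D, ← mul_assoc, mul_comm s, hbs, one_mul]
  have hfm := hfc.measurable
  have hae := ae_restrict_of_ae (s := Ioc 0 (0 + s))
    (h.ae_forall ENNReal.ofReal_ne_top ENNReal.ofReal_ne_top K)
  have henorm : ∀ z : ℂ, ‖(starRingEnd ℂ) z‖ₑ = ‖z‖ₑ := fun z => by
    rw [← ofReal_norm, RCLike.norm_conj, ofReal_norm]
  rw [hconst A, hconst B, mul_assoc, mul_assoc,
    ← lintegral_const_mul (ENNReal.ofReal (A * b)) (by fun_prop),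
    ← lintegral_const_mul (ENNReal.ofReal (B * b)) (by fun_prop)]
  constructor
  · gcongr ENNReal.ofReal s * ?_
    refine lintegral_mono_ae (hae.mono fun x hx => ?_)
    simpa only [henorm] using (hx fun k => (starRingEnd ℂ) (f (x - k * s))).1
  · gcongr ENNReal.ofReal s * ?_
    refine lintegral_mono_ae (hae.mono fun x hx => ?_)
    simpa only [henorm] using (hx fun k => (starRingEnd ℂ) (f (x - k * s))).2

lemma IsFrameWith.fiberBounds (hs : 0 < s) (hbs : b * s = 1) (hA : 0 ≤ A) (hB : 0 ≤ B)
    (hgm : Measurable g) (hg : MemLp g 2) {G : ℤ × ℤ → L2R} (hG : RepresentsGabor G g a b)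
    (h : IsFrameWith G A B) :
    FiberBounds g a s (ENNReal.ofReal (A * b)) (ENNReal.ofReal (B * b)) := by
  rw [isFrameWith_iff_enorm hA hB] at h
  intro K d
  refine ae_of_forall_ae_Ioc hs fun t => ?_
  have hb : 0 ≤ b := by
    by_contra! hb
    nlinarith [mul_neg_of_neg_of_pos hb hs]
  have hSm : Measurable (fiberSum g a s K d) :=
    measurable_fiberSum_comp hgm K (d := fun _ => d) fun k => measurable_const
  have key : ∀ E : Set ℝ, MeasurableSet E →
      ∫⁻ _ in E, ENNReal.ofReal (A * b) * ∑ k ∈ K, ‖d k‖ₑ ^ 2 ∂volume.restrict (Ioc t (t + s))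
        ≤ ∫⁻ x in E, fiberSum g a s K d x ∂volume.restrict (Ioc t (t + s)) ∧
      ∫⁻ x in E, fiberSum g a s K d x ∂volume.restrict (Ioc t (t + s)) ≤
        ∫⁻ _ in E, ENNReal.ofReal (B * b) * ∑ k ∈ K, ‖d k‖ₑ ^ 2
          ∂volume.restrict (Ioc t (t + s)) := by
    intro E hE
    let E' := E ∩ Ioc t (t + s)
    have hE' : MeasurableSet E' := hE.inter measurableSet_Ioc
    let f : ℝ → ℂ := fun y => ∑ k ∈ K,
      ((fun y : ℝ => y + k * s) ⁻¹' E').indicator (fun _ => (starRingEnd ℂ) (d k)) y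
    have hmeas : ∀ k : ℤ, MeasurableSet ((fun y : ℝ => y + k * s) ⁻¹' E') := fun k =>
      hE'.preimage (by fun_prop)
    have hf : Measurable f := Finset.measurable_fun_sum _ fun k _ =>
      measurable_const.indicator (hmeas k)
    have hfb : ∀ y, ‖f y‖ ≤ ∑ k ∈ K, ‖d k‖ := fun y =>
      (norm_sum_le _ _).trans (Finset.sum_le_sum fun k _ => by
        simpa using norm_indicator_le_norm_self (fun _ : ℝ => (starRingEnd ℂ) (d k)) y)
    have hfL : MemLp f 2 := memLp_finsetSum _ fun k _ =>
      memLp_indicator_const 2 (hmeas k) _ (Or.inr (by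
        rw [measure_preimage_add_right]
        exact ne_top_of_le_ne_top (by simp) (measure_mono (inter_subset_right))))
    have hval : ∀ x ∈ Ioc t (t + s), ∀ k : ℤ, f (x - k * s) =
        if k ∈ K then E.indicator (fun _ => (starRingEnd ℂ) (d k)) x else 0 := by
      intro x hx k
      have hterm : ∀ j : ℤ, ((fun y : ℝ => y + j * s) ⁻¹' E').indicator
          (fun _ => (starRingEnd ℂ) (d j)) (x - k * s)
            = if k = j then E.indicator (fun _ => (starRingEnd ℂ) (d k)) x else 0 := by
        intro j
        split_ifs with hkj
        · subst hkj
          have : x - k * s ∈ (fun y : ℝ => y + k * s) ⁻¹' E' ↔ x ∈ E := by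
            simp [E', mem_preimage, hx.1, hx.2]
          by_cases hxE : x ∈ E
          · rw [indicator_of_mem (this.2 hxE), indicator_of_mem hxE]
          · rw [indicator_of_notMem (mt this.1 hxE), indicator_of_notMem hxE]
        · refine indicator_of_notMem (fun hmem => hkj ?_) _
          have h1 : x - k * s + j * s ∈ Ioc t (t + s) := hmem.2
          have h2 : x - k * s + k * s ∈ Ioc t (t + s) := by simpa using hx
          exact eq_of_add_int_mul_mem_Ioc hs h2 h1
      simp only [f, hterm]
      exact Finset.sum_ite_eq K k _
    have hK : ∀ x ∈ Ioc t (t + s), ∀ k ∉ K, f (x - k * s) = 0 := fun x hx k hk => by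
      rw [hval x hx k, if_neg hk]
    have h1 := enorm_sq_eq_lintegral_Ioc_sum hs t hf hK hfL.coeFn_toLp
    have h2 := tsum_enorm_inner_gabor hs hbs t hgm hg hG hf hfb hK hfL.coeFn_toLp
    have h1' : ∫⁻ x in Ioc t (t + s), ∑ k ∈ K, ‖f (x - k * s)‖ₑ ^ 2
        = ∫⁻ _ in E, ∑ k ∈ K, ‖d k‖ₑ ^ 2 ∂volume.restrict (Ioc t (t + s)) := by
      rw [← lintegral_indicator hE]
      refine setLIntegral_congr_fun measurableSet_Ioc fun x hx => ?_
      simp only [hval x hx]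
      by_cases hxE : x ∈ E
      · simp only [indicator_of_mem hxE]
        refine Finset.sum_congr rfl fun k hk => ?_
        rw [if_pos hk, ← ofReal_norm, RCLike.norm_conj, ofReal_norm]
      · simp [indicator_of_notMem hxE]
    have h2' : ∫⁻ x in Ioc t (t + s),
          fiberSum g a s K (fun k => (starRingEnd ℂ) (f (x - k * s))) x
        = ∫⁻ x in E, fiberSum g a s K d x ∂volume.restrict (Ioc t (t + s)) := by
      rw [← lintegral_indicator hE]
      refine setLIntegral_congr_fun measurableSet_Ioc fun x hx => ?_
      simp only [hval x hx]
      by_cases hxE : x ∈ E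
      · simp only [indicator_of_mem hxE]
        refine tsum_congr fun l => ?_
        congr 2
        exact Finset.sum_congr rfl fun k hk => by simp only [if_pos hk, Complex.conj_conj]
      · simp [indicator_of_notMem hxE, fiberSum]
    obtain ⟨h3, h4⟩ := h (hfL.toLp f)
    rw [h1, h2, h1', h2'] at h3 h4
    have hbs' : ENNReal.ofReal b * ENNReal.ofReal s = 1 := by
      rw [← ENNReal.ofReal_mul hb, hbs, ENNReal.ofReal_one]
    rw [lintegral_const_mul _ measurable_const, lintegral_const_mul _ measurable_const,
      mul_comm A, mul_comm B, ENNReal.ofReal_mul hb, ENNReal.ofReal_mul hb]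
    have h3' := mul_le_mul_right h3 (ENNReal.ofReal b)
    have h4' := mul_le_mul_right h4 (ENNReal.ofReal b)
    rw [← mul_assoc, ← mul_assoc, hbs', one_mul] at h3' h4'
    exact ⟨h3', h4'⟩
  filter_upwards [ae_le_of_forall_setLIntegral_le_of_sigmaFinite measurable_const
    fun E hE _ => (key E hE).1, ae_le_of_forall_setLIntegral_le_of_sigmaFinite hSm
    fun E hE _ => (key E hE).2] with x h1 h2
  exact ⟨h1, h2⟩

end FrameSide

section RieszSide

variable {g : ℝ → ℂ} {a b s β : ℝ} {w : ℂ} {G' : ℤ × ℤ → L2R}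

lemma enorm_sq_sum_smul_gabor (ha : 0 < a) (hβ : β * a = 1) (t : ℝ) (hg : Measurable g)
    (hG' : ∀ p : ℤ × ℤ, G' p =ᵐ[volume] fun x => w * gaborFun g s β p.1 p.2 x)
    (M K : Finset ℤ) (c : ℤ × ℤ → ℂ) :
    ‖∑ p ∈ M ×ˢ K, c p • G' p‖ₑ ^ 2 = ‖w‖ₑ ^ 2 * ∫⁻ x in Ioc t (t + a),
      fiberSum g a s K (fun k => ∑ m ∈ M, c (m, k) * expChar β m x) x := by
  have hexp : ∀ m, Measurable (expChar β m) := fun m => (continuous_expChar β m).measurable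
  have hae : ⇑(∑ p ∈ M ×ˢ K, c p • G' p) =ᵐ[volume]
      fun x => w * ∑ k ∈ K, (∑ m ∈ M, c (m, k) * expChar β m x) * g (x - k * s) := by
    have h1 : ∀ᵐ x : ℝ, ∀ p : ℤ × ℤ, G' p x = w * gaborFun g s β p.1 p.2 x ∧
        (c p • G' p : L2R) x = c p • G' p x :=
      ae_all_iff.2 fun p => (hG' p).and (Lp.coeFn_smul (c p) (G' p))
    filter_upwards [h1, Lp.coeFn_finsetSum (M ×ˢ K) fun p => c p • G' p] with x h1 h2
    rw [h2, Finset.sum_apply, Finset.sum_product_right, Finset.mul_sum]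
    refine Finset.sum_congr rfl fun k _ => ?_
    rw [Finset.sum_mul, Finset.mul_sum]
    refine Finset.sum_congr rfl fun m _ => ?_
    rw [(h1 (m, k)).2, (h1 (m, k)).1, gaborFun, expChar, smul_eq_mul]
    ring
  rw [Lp_enorm_sq_eq_lintegral, lintegral_congr_ae (hae.mono fun x hx => by rw [hx]),
    lintegral_eq_lintegral_Ioc_tsum_add ha t (by fun_prop),
    ← lintegral_const_mul _ (measurable_fiberSum_comp hg K fun k => by fun_prop)]
  refine lintegral_congr fun x => ?_
  rw [fiberSum, ← ENNReal.tsum_mul_left]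
  simp only [expChar_add_int_mul hβ, enorm_mul, mul_pow]

variable {A B : ℝ}

lemma FiberBounds.isRieszSeqWith (ha : 0 < a) (hβ : β * a = 1) (hA : 0 ≤ A)
    (hB : 0 ≤ B) (hw : ‖w‖ₑ ^ 2 * (ENNReal.ofReal b * ENNReal.ofReal a) = 1) (hg : Measurable g)
    (hG' : ∀ p : ℤ × ℤ, G' p =ᵐ[volume] fun x => w * gaborFun g s β p.1 p.2 x)
    (h : FiberBounds g a s (ENNReal.ofReal (A * b)) (ENNReal.ofReal (B * b))) :
    IsRieszSeqWith G' A B := by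
  refine isRieszSeqWith_of_product hA hB fun M K c => ?_
  have hexp : ∀ m, Measurable (expChar β m) := fun m => (continuous_expChar β m).measurable
  have hint : ∫⁻ x in Ioc 0 (0 + a), ∑ k ∈ K, ‖∑ m ∈ M, c (m, k) * expChar β m x‖ₑ ^ 2
      = ENNReal.ofReal a * ∑ p ∈ M ×ˢ K, ‖c p‖ₑ ^ 2 := by
    rw [lintegral_finsetSum _ fun k _ => by fun_prop, Finset.sum_product_right, Finset.mul_sum]
    exact Finset.sum_congr rfl fun k _ => lintegral_Ioc_enorm_sq_trigPoly ha hβ 0 M _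
  have hconst : ∀ D : ℝ, 0 ≤ D → ENNReal.ofReal D * ∑ p ∈ M ×ˢ K, ‖c p‖ₑ ^ 2 =
      ‖w‖ₑ ^ 2 * ∫⁻ x in Ioc 0 (0 + a), ENNReal.ofReal (D * b) *
        ∑ k ∈ K, ‖∑ m ∈ M, c (m, k) * expChar β m x‖ₑ ^ 2 := by
    intro D hD
    rw [lintegral_const_mul _ (by fun_prop), hint, ENNReal.ofReal_mul hD]
    calc _ = (‖w‖ₑ ^ 2 * (ENNReal.ofReal b * ENNReal.ofReal a)) *
          (ENNReal.ofReal D * ∑ p ∈ M ×ˢ K, ‖c p‖ₑ ^ 2) := by rw [hw, one_mul]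
      _ = _ := by ring
  have hae := ae_restrict_of_ae (s := Ioc 0 (0 + a))
    (h.ae_forall ENNReal.ofReal_ne_top ENNReal.ofReal_ne_top K)
  rw [enorm_sq_sum_smul_gabor ha hβ 0 hg hG', hconst A hA, hconst B hB]
  exact ⟨mul_le_mul_right (lintegral_mono_ae (hae.mono fun x hx => (hx _).1)) _,
    mul_le_mul_right (lintegral_mono_ae (hae.mono fun x hx => (hx _).2)) _⟩

lemma IsRieszSeqWith.fiberBounds (ha : 0 < a) (hβ : β * a = 1) (hA : 0 ≤ A)
    (hB : 0 ≤ B) (hw : ‖w‖ₑ ^ 2 * (ENNReal.ofReal b * ENNReal.ofReal a) = 1) (hg : Measurable g)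
    (hG' : ∀ p : ℤ × ℤ, G' p =ᵐ[volume] fun x => w * gaborFun g s β p.1 p.2 x)
    (h : IsRieszSeqWith G' A B) :
    FiberBounds g a s (ENNReal.ofReal (A * b)) (ENNReal.ofReal (B * b)) := by
  rw [isRieszSeqWith_iff_enorm hA hB] at h
  intro K d
  refine ae_of_forall_ae_Ioc ha fun t => ?_
  have hSm : Measurable (fiberSum g a s K d) :=
    measurable_fiberSum_comp hg K (d := fun _ => d) fun k => measurable_const
  have hexp : ∀ m, Measurable (expChar β m) := fun m => (continuous_expChar β m).measurable
  have hw0 : ‖w‖ₑ ^ 2 ≠ 0 := left_ne_zero_of_mul_eq_one hw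
  have hwt : ‖w‖ₑ ^ 2 ≠ ⊤ := by simp
  have key : ∀ (M : Finset ℤ) (c : ℤ → ℂ),
      ∫⁻ x in Ioc t (t + a), ‖∑ m ∈ M, c m * expChar β m x‖ₑ ^ 2 *
          (ENNReal.ofReal (A * b) * ∑ k ∈ K, ‖d k‖ₑ ^ 2)
        ≤ ∫⁻ x in Ioc t (t + a), ‖∑ m ∈ M, c m * expChar β m x‖ₑ ^ 2 * fiberSum g a s K d x ∧
      ∫⁻ x in Ioc t (t + a), ‖∑ m ∈ M, c m * expChar β m x‖ₑ ^ 2 * fiberSum g a s K d x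
        ≤ ∫⁻ x in Ioc t (t + a), ‖∑ m ∈ M, c m * expChar β m x‖ₑ ^ 2 *
          (ENNReal.ofReal (B * b) * ∑ k ∈ K, ‖d k‖ₑ ^ 2) := by
    intro M c
    obtain ⟨h1, h2⟩ := h (M ×ˢ K) fun p => c p.1 * d p.2
    rw [enorm_sq_sum_smul_gabor ha hβ t hg hG'] at h1 h2
    have hfib : ∀ x, fiberSum g a s K (fun k => ∑ m ∈ M, c m * d k * expChar β m x) x
        = ‖∑ m ∈ M, c m * expChar β m x‖ₑ ^ 2 * fiberSum g a s K d x := by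
      intro x
      rw [← fiberSum_mul_left]
      congr 1 with k
      rw [Finset.sum_mul]
      exact Finset.sum_congr rfl fun m _ => by ring
    have hconst : ∀ D : ℝ, 0 ≤ D → ENNReal.ofReal D * ∑ p ∈ M ×ˢ K, ‖c p.1 * d p.2‖ₑ ^ 2 =
        ‖w‖ₑ ^ 2 * ∫⁻ x in Ioc t (t + a), ‖∑ m ∈ M, c m * expChar β m x‖ₑ ^ 2 *
          (ENNReal.ofReal (D * b) * ∑ k ∈ K, ‖d k‖ₑ ^ 2) := by
      intro D hD
      rw [lintegral_mul_const _ (by fun_prop), lintegral_Ioc_enorm_sq_trigPoly ha hβ,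
        ENNReal.ofReal_mul hD]
      rw [Finset.sum_product]
      simp only [enorm_mul, mul_pow]
      rw [← Finset.sum_mul_sum]
      calc _ = (‖w‖ₑ ^ 2 * (ENNReal.ofReal b * ENNReal.ofReal a)) *
            (ENNReal.ofReal D * ((∑ m ∈ M, ‖c m‖ₑ ^ 2) * ∑ k ∈ K, ‖d k‖ₑ ^ 2)) := by
              rw [hw, one_mul]
        _ = _ := by ring
    simp only [hfib] at h1 h2
    rw [hconst A hA] at h1
    rw [hconst B hB] at h2
    exact ⟨(ENNReal.mul_le_mul_iff_right hw0 hwt).1 h1, (ENNReal.mul_le_mul_iff_right hw0 hwt).1 h2⟩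
  have hcfin : ∀ D : ℝ, ∫⁻ _ in Ioc t (t + a),
      ENNReal.ofReal D * ∑ k ∈ K, ‖d k‖ₑ ^ 2 ≠ ⊤ := fun D => by
    rw [lintegral_const]
    exact ENNReal.mul_ne_top (ENNReal.mul_ne_top ENNReal.ofReal_ne_top (by simp)) (by simp)
  have hSfin : ∫⁻ x in Ioc t (t + a), fiberSum g a s K d x ≠ ⊤ := by
    have := (key {0} fun _ => 1).2
    simp only [Finset.sum_singleton, one_mul, ← ofReal_norm (expChar _ _ _), norm_expChar,
      ENNReal.ofReal_one, one_pow] at this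
    exact ne_top_of_le_ne_top (hcfin _) this
  filter_upwards [
    ae_le_of_forall_trigPoly_lintegral_le ha hβ t measurable_const hSm (hcfin _) hSfin
      fun M c => (key M c).1,
    ae_le_of_forall_trigPoly_lintegral_le ha hβ t hSm measurable_const hSfin (hcfin _)
      fun M c => (key M c).2] with x h1 h2
  exact ⟨h1, h2⟩

end RieszSide

end GaborDuality

theorem gabor_duality_principle
    (g : L2R) (a b : ℝ) (ha : 0 < a) (hb : 0 < b) (A B : ℝ) (hA : 0 < A) (hB : 0 < B)
    (G G' : ℤ × ℤ → L2R)
    (hG : RepresentsGabor G (g : ℝ → ℂ) a b)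
    -- `G'` represents the dual lattice system `{(ab)^{-1/2} E_{m/a}T_{n/b} g}_{m,n ∈ ℤ}`
    (hG' : ∀ p : ℤ × ℤ, (G' p : ℝ → ℂ) =ᵐ[volume]
      fun x => ((Real.sqrt (a * b))⁻¹ : ℂ) * gaborFun (g : ℝ → ℂ) (1 / b) (1 / a) p.1 p.2 x) :
    IsFrameWith G A B ↔ IsRieszSeqWith G' A B := by
  have hgm : Measurable (g : ℝ → ℂ) := (Lp.stronglyMeasurable g).measurable
  have hg := Lp.memLp g
  have hs : 0 < 1 / b := by positivity
  have hbs : b * (1 / b) = 1 := mul_one_div_cancel hb.ne'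
  have hβ : 1 / a * a = 1 := one_div_mul_cancel ha.ne'
  have hw : ‖((Real.sqrt (a * b))⁻¹ : ℂ)‖ₑ ^ 2 * (ENNReal.ofReal b * ENNReal.ofReal a) = 1 := by
    rw [← ofReal_norm, ← ENNReal.ofReal_pow (norm_nonneg _), ← ENNReal.ofReal_mul hb.le,
      ← ENNReal.ofReal_mul (by positivity), norm_inv, Complex.norm_real, Real.norm_eq_abs,
      abs_of_nonneg (Real.sqrt_nonneg _), inv_pow, Real.sq_sqrt (by positivity), mul_comm b,
      inv_mul_cancel₀ (by positivity), ENNReal.ofReal_one]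
  exact ⟨fun h => (h.fiberBounds hs hbs hA.le hB.le hgm hg hG).isRieszSeqWith
      ha hβ hA.le hB.le hw hgm hG',
    fun h => (h.fiberBounds ha hβ hA.le hB.le hw hgm hG').isFrameWith
      hs hbs hA.le hB.le hgm hg hG⟩
end
end
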